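/- Let A be an n×n Hermitian positive semidefinite matrix with integer entries and let K ≥ 1 be a real number with ‖A‖ ≤ K². Then ∫_{(0, K²]} (E_A(λ) − E_A(0))/λ dλ ≤ log(K²)·(E_A(K²) − E_A(0)) = log(K²)·(n − E_A(0)). -/

import Mathlib

open scoped ComplexOrder

theorem aux_trailing {n : ℕ} (μ : Fin n → ℝ) (s : Finset (Fin n)) :
    (∏ i ∈ s, (Polynomial.X - Polynomial.C ((μ i : ℝ) : ℂ))).trailingCoeff
      = ∏ i ∈ s with μ i ≠ 0, (-(μ i : ℂ)) := by
  induction s using Finset.induction_on with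
  | empty => simp [Polynomial.trailingCoeff]
  | insert a s ha ih =>
    rw [Finset.prod_insert ha, Polynomial.trailingCoeff_mul, ih, Finset.filter_insert]
    by_cases h : μ a = 0
    · simp [h, Polynomial.trailingCoeff]
    · rw [if_pos h, Finset.prod_insert (by simp [ha])]
      congr 1
      have h0 : (Polynomial.X - Polynomial.C ((μ a : ℝ) : ℂ)).coeff 0 ≠ 0 := by simpa using h
      have : (Polynomial.X - Polynomial.C ((μ a : ℝ) : ℂ)).natTrailingDegree = 0 := by
        rw [Polynomial.natTrailingDegree_eq_zero]; right; exact h0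
      rw [Polynomial.trailingCoeff, this]; simp

theorem aux_prod {n : ℕ} {A : Matrix (Fin n) (Fin n) ℂ} (hA : A.PosSemidef)
    (hint : ∀ i j, ∃ z : ℤ, A i j = (z : ℂ)) :
    1 ≤ ∏ i with hA.1.eigenvalues i ≠ 0, hA.1.eigenvalues i := by
  choose B hB using hint
  have hAB : A = (Matrix.of B).map (Int.castRingHom ℂ) := by
    ext i j; simp [hB]
  have h1 := hA.1.charpoly_eq
  have h2 : A.charpoly = (Matrix.of B).charpoly.map (Int.castRingHom ℂ) := by
    conv_lhs => rw [hAB]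
    exact Matrix.charpoly_map _ _
  have h3 := aux_trailing hA.1.eigenvalues Finset.univ
  have h4 : A.charpoly.trailingCoeff = (((Matrix.of B).charpoly.trailingCoeff : ℤ) : ℂ) := by
    have hinj : Function.Injective (Int.castRingHom ℂ) := Int.cast_injective
    have hd : ((Matrix.of B).charpoly.map (Int.castRingHom ℂ)).natTrailingDegree
        = (Matrix.of B).charpoly.natTrailingDegree := by
      rw [Polynomial.natTrailingDegree_eq_support_min',
        Polynomial.natTrailingDegree_eq_support_min']
      · congr 1
        exact Polynomial.support_map_of_injective _ hinj
      · exact (Matrix.charpoly_monic _).ne_zero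
      · exact ((Matrix.charpoly_monic _).map _).ne_zero
    rw [h2, Polynomial.trailingCoeff, Polynomial.coeff_map, hd]
    rfl
  have hz : (Matrix.of B).charpoly.trailingCoeff ≠ 0 := by
    rw [Ne, Polynomial.trailingCoeff_eq_zero]
    exact (Matrix.charpoly_monic _).ne_zero
  have h5 : ‖A.charpoly.trailingCoeff‖ = ∏ i with hA.1.eigenvalues i ≠ 0, hA.1.eigenvalues i := by
    rw [h1]
    refine (congrArg norm h3).trans ?_
    rw [norm_prod]
    refine Finset.prod_congr rfl fun i _ => ?_
    rw [norm_neg, Complex.norm_real, Real.norm_of_nonneg (hA.eigenvalues_nonneg i)]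
  rw [← h5, h4, Complex.norm_intCast]
  exact_mod_cast Int.one_le_abs hz

theorem aux_le {n : ℕ} {A : Matrix (Fin n) (Fin n) ℂ} (hA : A.PosSemidef) (i : Fin n) :
    hA.1.eigenvalues i ≤ ‖Matrix.toEuclideanCLM (𝕜 := ℂ) A‖ := by
  have h := (Matrix.toEuclideanCLM (𝕜 := ℂ) A).le_opNorm (hA.1.eigenvectorBasis i)
  have h2 : Matrix.toEuclideanCLM (𝕜 := ℂ) A (hA.1.eigenvectorBasis i)
      = hA.1.eigenvalues i • hA.1.eigenvectorBasis i := by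
    have := hA.1.mulVec_eigenvectorBasis i
    apply (WithLp.ofLp_injective 2)
    rw [Matrix.ofLp_toEuclideanCLM, this]
    rfl
  rw [h2, norm_smul, OrthonormalBasis.norm_eq_one, mul_one, mul_one,
    Real.norm_of_nonneg (hA.eigenvalues_nonneg i)] at h
  exact h

theorem aux_int (μ M : ℝ) (h0 : 0 < μ) (h1 : μ ≤ M) :
    ∫⁻ x in Set.Ioc (0 : ℝ) M, (Set.Ici μ).indicator (fun x => ENNReal.ofReal (1 / x)) x
      = ENNReal.ofReal (Real.log M - Real.log μ) := by
  rw [MeasureTheory.lintegral_indicator measurableSet_Ici,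
    MeasureTheory.Measure.restrict_restrict measurableSet_Ici]
  have : Set.Ici μ ∩ Set.Ioc 0 M = Set.Icc μ M := by
    ext x; simp only [Set.mem_inter_iff, Set.mem_Ici, Set.mem_Ioc, Set.mem_Icc]
    constructor
    · rintro ⟨a, b, c⟩; exact ⟨a, c⟩
    · rintro ⟨a, b⟩; exact ⟨a, by linarith, b⟩
  rw [this, ← MeasureTheory.restrict_Ioc_eq_restrict_Icc]
  have hni : (0 : ℝ) ∉ Set.uIcc μ M := by
    rw [Set.uIcc_of_le h1]; intro h; linarith [h.1]
  have hi : IntervalIntegrable (fun x : ℝ => 1 / x) MeasureTheory.volume μ M :=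
    intervalIntegral.intervalIntegrable_one_div (fun x hx h => hni (h ▸ hx)) continuousOn_id
  rw [← MeasureTheory.ofReal_integral_eq_lintegral_ofReal, ← intervalIntegral.integral_of_le h1,
    integral_one_div hni, Real.log_div (by linarith) h0.ne']
  · exact (intervalIntegrable_iff_integrableOn_Ioc_of_le h1).1 hi
  · filter_upwards [MeasureTheory.ae_restrict_mem measurableSet_Ioc] with x hx
    have : 0 < x := h0.trans hx.1
    simp only [Pi.zero_apply]
    positivity




/-- Let `A` be an `n × n` Hermitian positive semidefinite matrix with integer entries and
let `K ≥ 1` satisfy `‖A‖ ≤ K²`.  Then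
`∫_{(0,K²]} (E_A(λ) − E_A(0))/λ dλ ≤ log K² · (E_A(K²) − E_A(0)) = log K² · (n − E_A(0))`. -/
theorem integral_spectral_density_le
    {n : ℕ} {A : Matrix (Fin n) (Fin n) ℂ}
    (hA : A.PosSemidef)
    (hint : ∀ i j, ∃ z : ℤ, A i j = (z : ℂ))
    (K : ℝ) (hK : 1 ≤ K) (hnorm : ‖Matrix.toEuclideanCLM (𝕜 := ℂ) A‖ ≤ K ^ 2)
    (E : ℝ → ℕ)
    (hE : ∀ t : ℝ, E t = (Finset.univ.filter fun i : Fin n =>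
      hA.1.eigenvalues i ≤ t).card) :
    E (K ^ 2) = n ∧
    ∫⁻ lam in Set.Ioc (0 : ℝ) (K ^ 2),
        ENNReal.ofReal (((E lam : ℝ) - E 0) / lam) ≤
      ENNReal.ofReal (Real.log (K ^ 2) * ((E (K ^ 2) : ℝ) - E 0)) := by
  have hle : ∀ i, hA.1.eigenvalues i ≤ K ^ 2 := fun i => (aux_le hA i).trans hnorm
  have hpos : ∀ i, 0 ≤ hA.1.eigenvalues i := hA.eigenvalues_nonneg
  have hprod := aux_prod hA hint
  generalize hA.1.eigenvalues = μ at *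
  have hEn : E (K ^ 2) = n := by
    rw [hE, Finset.filter_true_of_mem (fun i _ => hle i)]; simp
  refine ⟨hEn, ?_⟩
  set S : Finset (Fin n) := Finset.univ.filter fun i => μ i ≠ 0 with hS
  have hSpos : ∀ i ∈ S, 0 < μ i := fun i hi =>
    lt_of_le_of_ne (hpos i) (Ne.symm (Finset.mem_filter.1 hi).2)
  have hdiff : ∀ t : ℝ, 0 ≤ t → (E t : ℝ) - E 0 = ∑ i ∈ S, if μ i ≤ t then (1 : ℝ) else 0 := by
    intro t ht
    have e : ∀ s : ℝ, (E s : ℝ) = ∑ i, if μ i ≤ s then (1 : ℝ) else 0 := by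
      intro s; rw [hE s]; simp
    rw [e, e, ← Finset.sum_sub_distrib, hS, Finset.sum_filter]
    refine Finset.sum_congr rfl fun i _ => ?_
    by_cases h : μ i = 0
    · simp [h, ht]
    · have : ¬ μ i ≤ 0 := fun h' => h (le_antisymm h' (hpos i))
      simp [h, this]
  have hcongr : ∫⁻ lam in Set.Ioc (0 : ℝ) (K ^ 2), ENNReal.ofReal (((E lam : ℝ) - E 0) / lam)
      = ∫⁻ lam in Set.Ioc (0 : ℝ) (K ^ 2),
        ∑ i ∈ S, (Set.Ici (μ i)).indicator (fun x => ENNReal.ofReal (1 / x)) lam := by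
    refine MeasureTheory.setLIntegral_congr_fun measurableSet_Ioc fun x hx => ?_
    have hx0 : 0 < x := hx.1
    rw [hdiff x hx0.le, Finset.sum_div, ENNReal.ofReal_sum_of_nonneg]
    · refine Finset.sum_congr rfl fun i _ => ?_
      by_cases h : μ i ≤ x <;> simp [h]
    · intro i _
      split_ifs <;> positivity
  rw [hcongr, MeasureTheory.lintegral_finsetSum]
  · rw [Finset.sum_congr rfl fun i hi => aux_int (μ i) (K ^ 2) (hSpos i hi) (hle i),
      ← ENNReal.ofReal_sum_of_nonneg]
    · apply ENNReal.ofReal_le_ofReal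
      rw [hdiff _ (by positivity), Finset.sum_sub_distrib,
        ← Real.log_prod (fun i hi => (hSpos i hi).ne')]
      have := Real.log_nonneg hprod
      simp only [hle, if_true, Finset.sum_const, nsmul_eq_mul, mul_one]
      linarith
    · intro i hi
      exact sub_nonneg.2 (Real.log_le_log (hSpos i hi) (hle i))
  · intro i _
    exact Measurable.indicator (by fun_prop) measurableSet_Ici
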